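/- For any 3-tensor T over any field K, GR(T) = min over r ∈ ℕ of (r + codim{x ∈ \bar{K}^{n_1} : rank of the matrix T(x,·,·) equals r}). -/

import Mathlib

/-- A (possibly reducible) affine subvariety of `K^n`: the common zero set of a collection of
polynomials. -/
def IsSubvariety {K : Type*} [Field K] {n : ℕ} (W : Set (Fin n → K)) : Prop :=
  ∃ S : Set (MvPolynomial (Fin n) K), W = {x | ∀ p ∈ S, MvPolynomial.eval x p = 0}

/-- An irreducible subvariety: a nonempty subvariety that cannot be covered by two subvarieties
unless it is contained in one of them. -/
def IsIrreducibleSubvariety {K : Type*} [Field K] {n : ℕ} (W : Set (Fin n → K)) : Prop :=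
  IsSubvariety W ∧ W.Nonempty ∧ ∀ W₁ W₂ : Set (Fin n → K), IsSubvariety W₁ → IsSubvariety W₂ →
    W ⊆ W₁ ∪ W₂ → W ⊆ W₁ ∨ W ⊆ W₂

/-- The dimension of a variety `V`: the maximal length `k` of a strict chain
`C 0 ⊊ C 1 ⊊ ⋯ ⊊ C k` of irreducible subvarieties contained in `V`. -/
noncomputable def varDim {K : Type*} [Field K] {n : ℕ} (V : Set (Fin n → K)) : ℕ :=
  sSup {k | ∃ C : Fin (k + 1) → Set (Fin n → K),
    (∀ i, IsIrreducibleSubvariety (C i)) ∧ (∀ i, C i ⊆ V) ∧ StrictMono C}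

open scoped BigOperators
open Classical

/-- The Zariski closure of a set: the intersection of all subvarieties containing it. -/
def zariskiClosure {K : Type*} [Field K] {n : ℕ} (S : Set (Fin n → K)) : Set (Fin n → K) :=
  ⋂₀ {W | IsSubvariety W ∧ S ⊆ W}

/-- The codimension of a (constructible) subset of `K^n`, valued in `ℕ∞`: the codimension of
its Zariski closure, with the convention that the empty set has codimension `⊤`. -/

noncomputable def codimE {K : Type*} [Field K] {n : ℕ} (S : Set (Fin n → K)) : ℕ∞ :=
  if S = ∅ then ⊤ else ((n - varDim (zariskiClosure S) : ℕ) : ℕ∞)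

section GeometricRank

open MvPolynomial

universe u

/-- A finitely generated domain over a field has finite Krull dimension, equal to its
transcendence degree. -/
lemma exists_ringKrullDim_eq_and_trdeg_eq (F A : Type u) [Field F] [CommRing A] [IsDomain A]
    [Algebra F A] [Algebra.FiniteType F A] :
    ∃ s : ℕ, ringKrullDim A = s ∧ Algebra.trdeg F A = s := by
  obtain ⟨s, g, hg, hint⟩ := exists_integral_inj_algHom_of_fg F A
  refine ⟨s, ?_, ?_⟩
  · let _ : Algebra (MvPolynomial (Fin s) F) A := g.toRingHom.toAlgebra
    have : Algebra.IsIntegral (MvPolynomial (Fin s) F) A := ⟨hint⟩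
    have hs : ringKrullDim (MvPolynomial (Fin s) F) = s := by
      simp [MvPolynomial.ringKrullDim_of_isNoetherianRing]
    apply le_antisymm
    · rw [← hs]
      refine Order.krullDim_le_of_strictMono
        (PrimeSpectrum.comap (algebraMap (MvPolynomial (Fin s) F) A)) fun I J h ↦ ?_
      exact Ideal.IsIntegral.comap_lt_comap (R := MvPolynomial (Fin s) F)
        (show I.asIdeal < J.asIdeal from h)
    · obtain ⟨l, hl⟩ := Order.le_krullDim_iff.mp hs.ge
      obtain ⟨P, -, hP, hPl⟩ := Ideal.exists_ideal_over_prime_of_isIntegral_of_isPrime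
        (R := MvPolynomial (Fin s) F) l.head.asIdeal (⊥ : Ideal A) (by
          intro x hx
          have hx : g x = 0 := hx
          rw [(map_eq_zero_iff g hg).mp hx]
          exact zero_mem _)
      have : P.LiesOver l.head.asIdeal := ⟨hPl.symm⟩
      obtain ⟨L, hL, -⟩ := Ideal.exists_ltSeries_of_hasGoingUp (S := A) l P
      exact Order.le_krullDim_iff.mpr ⟨L, hL.trans hl⟩
  · let _ : Algebra (MvPolynomial (Fin s) F) A := g.toRingHom.toAlgebra
    have : Algebra.IsIntegral (MvPolynomial (Fin s) F) A := ⟨hint⟩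
    have : IsScalarTower F (MvPolynomial (Fin s) F) A :=
      .of_algebraMap_eq fun x ↦ (g.commutes x).symm
    have : FaithfulSMul (MvPolynomial (Fin s) F) A :=
      (faithfulSMul_iff_algebraMap_injective _ _).mpr hg
    have h := trdeg_add_eq F (MvPolynomial (Fin s) F) (A := A)
    simpa [trdeg_eq_zero] using h.symm

section Dimension

variable {F : Type u} [Field F] {n : ℕ}

lemma isSubvariety_zeroLocus (I : Ideal (MvPolynomial (Fin n) F)) :
    IsSubvariety (zeroLocus F I) :=
  ⟨I, by ext; simp [aeval_eq_eval]⟩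

lemma IsSubvariety.zeroLocus_vanishingIdeal {W : Set (Fin n → F)} (hW : IsSubvariety W) :
    zeroLocus F (vanishingIdeal F W) = W := by
  obtain ⟨S, rfl⟩ := hW
  refine Set.Subset.antisymm (fun x hx p hp ↦ ?_) (zeroLocus_vanishingIdeal_le _)
  exact hx p fun y hy ↦ hy p hp

lemma IsSubvariety.subset_of_vanishingIdeal_le {W W' : Set (Fin n → F)} (hW' : IsSubvariety W')
    (h : vanishingIdeal F W' ≤ vanishingIdeal F W) : W ⊆ W' := by
  rw [← hW'.zeroLocus_vanishingIdeal]
  exact le_zeroLocus_iff_le_vanishingIdeal.mpr h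

lemma zariskiClosure_eq (S : Set (Fin n → F)) :
    zariskiClosure S = zeroLocus F (vanishingIdeal F S) := by
  apply Set.Subset.antisymm
  · exact Set.sInter_subset_of_mem ⟨isSubvariety_zeroLocus _, zeroLocus_vanishingIdeal_le S⟩
  · refine Set.subset_sInter fun W hW ↦ hW.1.subset_of_vanishingIdeal_le ?_
    exact (vanishingIdeal_anti_mono hW.2).trans (le_vanishingIdeal_zeroLocus _)

lemma vanishingIdeal_zariskiClosure (S : Set (Fin n → F)) :
    vanishingIdeal F (zariskiClosure S) = vanishingIdeal F S := by
  rw [zariskiClosure_eq]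
  exact le_antisymm (vanishingIdeal_anti_mono (zeroLocus_vanishingIdeal_le S))
    (le_vanishingIdeal_zeroLocus _)

lemma isSubvariety_zariskiClosure (S : Set (Fin n → F)) : IsSubvariety (zariskiClosure S) :=
  zariskiClosure_eq S ▸ isSubvariety_zeroLocus _

lemma IsIrreducibleSubvariety.isPrime_vanishingIdeal {W : Set (Fin n → F)}
    (hW : IsIrreducibleSubvariety W) : (vanishingIdeal F W).IsPrime := by
  obtain ⟨-, ⟨x, hx⟩, h⟩ := hW
  refine ⟨fun h1 ↦ ?_, fun {a b} hab ↦ ?_⟩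
  · have : (1 : MvPolynomial (Fin n) F) ∈ vanishingIdeal F W := h1 ▸ Submodule.mem_top
    simpa using this x hx
  · have := h {x | ∀ p ∈ ({a} : Set _), eval x p = 0} {x | ∀ p ∈ ({b} : Set _), eval x p = 0}
      ⟨_, rfl⟩ ⟨_, rfl⟩ fun y hy ↦ by
        have := hab y hy
        simpa [aeval_eq_eval] using this
    refine this.imp (fun h y hy ↦ ?_) fun h y hy ↦ ?_ <;> simpa [aeval_eq_eval] using h hy

lemma isIrreducibleSubvariety_zeroLocus [IsAlgClosed F] (P : Ideal (MvPolynomial (Fin n) F))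
    [hP : P.IsPrime] : IsIrreducibleSubvariety (zeroLocus F P) := by
  refine ⟨isSubvariety_zeroLocus P, ?_, fun W₁ W₂ h₁ h₂ hW ↦ ?_⟩
  · rw [Set.nonempty_iff_ne_empty]
    intro h
    apply hP.ne_top
    rw [← IsPrime.vanishingIdeal_zeroLocus (K := F) P, h, vanishingIdeal_empty]
  · have : vanishingIdeal F W₁ ≤ P ∨ vanishingIdeal F W₂ ≤ P := by
      refine hP.mul_le.mp (Ideal.mul_le.mpr fun f hf g hg ↦ ?_)
      rw [← IsPrime.vanishingIdeal_zeroLocus (K := F) P]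
      intro x hx
      obtain h | h := hW hx
      · rw [map_mul, hf x h, zero_mul]
      · rw [map_mul, hg x h, mul_zero]
    refine this.imp (fun h ↦ ?_) fun h ↦ ?_
    · exact h₁.subset_of_vanishingIdeal_le (by simpa using h)
    · exact h₂.subset_of_vanishingIdeal_le (by simpa using h)

lemma exists_chain_iff [IsAlgClosed F] {V : Set (Fin n → F)} (hV : IsSubvariety V) (k : ℕ) :
    (∃ C : Fin (k + 1) → Set (Fin n → F),
      (∀ i, IsIrreducibleSubvariety (C i)) ∧ (∀ i, C i ⊆ V) ∧ StrictMono C) ↔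
    (k : WithBot ℕ∞) ≤ ringKrullDim (MvPolynomial (Fin n) F ⧸ vanishingIdeal F V) := by
  rw [ringKrullDim_quotient, Order.le_krullDim_iff]
  constructor
  · rintro ⟨C, hC, hCV, hmono⟩
    refine ⟨⟨k, fun i ↦ ⟨⟨vanishingIdeal F (C i.rev), (hC _).isPrime_vanishingIdeal⟩,
      vanishingIdeal_anti_mono (hCV _)⟩, fun i ↦ ?_⟩, rfl⟩
    have hlt : C i.succ.rev < C i.castSucc.rev := hmono (by simp [Fin.rev_lt_rev])
    refine lt_of_le_not_ge (vanishingIdeal_anti_mono hlt.le) fun h ↦ hlt.not_ge ?_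
    exact (hC _).1.subset_of_vanishingIdeal_le h
  · rintro ⟨l, rfl⟩
    have hl (i) : (l i).1.asIdeal.IsPrime := (l i).1.isPrime
    refine ⟨fun i ↦ zeroLocus F (l i.rev).1.asIdeal,
      fun i ↦ isIrreducibleSubvariety_zeroLocus _, fun i ↦ ?_, fun i j hij ↦ ?_⟩
    · refine hV.subset_of_vanishingIdeal_le ?_
      simpa only [IsPrime.vanishingIdeal_zeroLocus] using! (l i.rev).2
    · have hlt : l j.rev < l i.rev := l.strictMono (Fin.rev_lt_rev.mpr hij)
      refine lt_of_le_not_ge (zeroLocus_anti_mono hlt.le) fun h ↦ hlt.not_ge ?_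
      have := vanishingIdeal_anti_mono (k := F) h
      simpa using this

lemma varDim_eq_ringKrullDim [IsAlgClosed F] {V : Set (Fin n → F)} (hV : IsSubvariety V)
    (hne : V.Nonempty) :
    (varDim V : WithBot ℕ∞) = ringKrullDim (MvPolynomial (Fin n) F ⧸ vanishingIdeal F V) ∧
      varDim V ≤ n := by
  have hle : ringKrullDim (MvPolynomial (Fin n) F ⧸ vanishingIdeal F V) ≤ n := by
    refine (ringKrullDim_quotient_le _).trans ?_
    simp [MvPolynomial.ringKrullDim_of_isNoetherianRing]
  have : Nontrivial (MvPolynomial (Fin n) F ⧸ vanishingIdeal F V) := by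
    refine Ideal.Quotient.nontrivial_iff.mpr fun h ↦ ?_
    obtain ⟨x, hx⟩ := hne
    have : (1 : MvPolynomial (Fin n) F) ∈ vanishingIdeal F V := h ▸ Submodule.mem_top
    simpa using this x hx
  obtain ⟨d, hd⟩ : ∃ d : ℕ,
      ringKrullDim (MvPolynomial (Fin n) F ⧸ vanishingIdeal F V) = d := by
    have h0 := ringKrullDim_nonneg_of_nontrivial
      (R := MvPolynomial (Fin n) F ⧸ vanishingIdeal F V)
    generalize ringKrullDim (MvPolynomial (Fin n) F ⧸ vanishingIdeal F V) = a at *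
    induction a with
    | bot => simp at h0
    | coe a =>
      induction a with
      | top => exact absurd hle (by exact_mod_cast not_le_of_gt (ENat.natCast_lt_top n))
      | coe a => exact ⟨a, rfl⟩
  have hvd : varDim V = d := by
    have : {k | ∃ C : Fin (k + 1) → Set (Fin n → F),
        (∀ i, IsIrreducibleSubvariety (C i)) ∧ (∀ i, C i ⊆ V) ∧ StrictMono C} = Set.Iic d := by
      ext k
      rw [Set.mem_ofPred_eq, exists_chain_iff hV, hd, Set.mem_Iic]
      exact_mod_cast Iff.rfl
    rw [varDim, this, csSup_Iic]
  refine ⟨hvd ▸ hd.symm, ?_⟩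
  rw [hd] at hle
  rw [hvd]
  exact_mod_cast hle

/-- The coordinates of a point of `V` in an extension `L` of the ground field
generate an algebra of transcendence degree at most `dim V`. -/
lemma trdeg_adjoin_le_varDim [IsAlgClosed F] {V : Set (Fin n → F)} (hV : IsSubvariety V)
    {L : Type u} [Field L] [Algebra F L] (ξ : Fin n → L)
    (hξ : ∀ f ∈ vanishingIdeal F V, aeval ξ f = 0) :
    Algebra.trdeg F (Algebra.adjoin F (Set.range ξ)) ≤ (varDim V : Cardinal.{u}) := by
  have hne : V.Nonempty := by
    rw [Set.nonempty_iff_ne_empty]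
    rintro rfl
    simpa using hξ 1 (by simp)
  have hfin : Algebra.FiniteType F (Algebra.adjoin F (Set.range ξ)) :=
    .adjoin_of_finite (Set.finite_range ξ)
  obtain ⟨s, hs, hs'⟩ := exists_ringKrullDim_eq_and_trdeg_eq F (Algebra.adjoin F (Set.range ξ))
  rw [hs']
  have hle : ringKrullDim (Algebra.adjoin F (Set.range ξ)) ≤
      ringKrullDim (MvPolynomial (Fin n) F ⧸ vanishingIdeal F V) := by
    rw [Algebra.adjoin_range_eq_range_aeval]
    refine ringKrullDim_le_of_surjective
      (Ideal.Quotient.lift _ (aeval ξ).rangeRestrict.toRingHom fun f hf ↦ ?_) ?_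
    · exact Subtype.ext (hξ f hf)
    · exact Ideal.Quotient.lift_surjective_of_surjective _ _ (aeval ξ).rangeRestrict_surjective
  rw [hs, ← (varDim_eq_ringKrullDim hV hne).1] at hle
  exact_mod_cast hle

/-- A variety `V` has a generic point over some extension of the ground field whose coordinates
generate an algebra of transcendence degree `dim V`. -/
lemma exists_varDim_le_trdeg_adjoin [IsAlgClosed F] {V : Set (Fin n → F)} (hV : IsSubvariety V)
    (hne : V.Nonempty) :
    ∃ (L : Type u) (_ : Field L) (_ : Algebra F L) (ξ : Fin n → L),
      (∀ f ∈ vanishingIdeal F V, aeval ξ f = 0) ∧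
      (varDim V : Cardinal.{u}) ≤ Algebra.trdeg F (Algebra.adjoin F (Set.range ξ)) := by
  have h := (varDim_eq_ringKrullDim hV hne).1.le
  rw [ringKrullDim_quotient, Order.le_krullDim_iff] at h
  obtain ⟨l, hl⟩ := h
  let P := l.head.1.asIdeal
  have hP : P.IsPrime := l.head.1.isPrime
  let A := MvPolynomial (Fin n) F ⧸ P
  let ξ : Fin n → FractionRing A := fun i ↦ algebraMap A _ (Ideal.Quotient.mk P (X i))
  have hξ : aeval ξ = (IsScalarTower.toAlgHom F A (FractionRing A)).comp
      (Ideal.Quotient.mkₐ F P) := by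
    ext i
    simp [ξ, A]
  have hinj : Function.Injective (IsScalarTower.toAlgHom F A (FractionRing A)) :=
    IsFractionRing.injective A (FractionRing A)
  refine ⟨FractionRing A, inferInstance, inferInstance, ξ, fun f hf ↦ ?_, ?_⟩
  · rw [hξ, AlgHom.comp_apply, Ideal.Quotient.mkₐ_eq_mk,
      Ideal.Quotient.eq_zero_iff_mem.mpr (l.head.2 hf), map_zero]
  · have hrange : Algebra.adjoin F (Set.range ξ) =
        (IsScalarTower.toAlgHom F A (FractionRing A)).range := by
      rw [Algebra.adjoin_range_eq_range_aeval, hξ]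
      rw [AlgHom.range_comp, (AlgHom.range_eq_top _).mpr (Ideal.Quotient.mkₐ_surjective F P),
        Algebra.map_top]
    rw [hrange, ← (AlgEquiv.ofInjective _ hinj).trdeg_eq]
    obtain ⟨s, hs, hs'⟩ := exists_ringKrullDim_eq_and_trdeg_eq F A
    rw [hs']
    have : (varDim V : WithBot ℕ∞) ≤ ringKrullDim A := by
      rw [ringKrullDim_quotient, Order.le_krullDim_iff]
      refine ⟨⟨l.length, fun i ↦ ⟨(l i).1, ?_⟩, fun i ↦ l.step i⟩, hl⟩
      exact (l.monotone (Fin.zero_le i) : l 0 ≤ l i)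
    rw [hs] at this
    exact_mod_cast this

end Dimension

section LinearAlgebra

variable {k m l : Type*} [Field k] [Fintype l]

lemma Matrix.exists_linearIndependent_submatrix_row [Fintype m] (A : Matrix m l k) {r : ℕ}
    (hr : r ≤ A.rank) :
    ∃ J : Fin r → m, LinearIndependent k (A.submatrix J id).row := by
  obtain ⟨κ, a, ha, hspan, hli⟩ := exists_linearIndependent' k A.row
  have : Fintype κ := .ofInjective a ha
  have hcard : Fintype.card κ = A.rank := by
    rw [A.rank_eq_finrank_span_row, ← hspan, finrank_span_eq_card hli]
  rw [← hcard] at hr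
  refine ⟨fun i ↦ a ((Fintype.equivFin κ).symm (Fin.castLE hr i)), ?_⟩
  exact hli.comp (fun i ↦ (Fintype.equivFin κ).symm (Fin.castLE hr i))
    ((Fintype.equivFin κ).symm.injective.comp (Fin.castLE_injective hr))

lemma Matrix.exists_det_submatrix_ne_zero [Fintype m] (A : Matrix m l k) {r : ℕ}
    (hr : r ≤ A.rank) :
    ∃ (J : Fin r → m) (C : Fin r → l), (A.submatrix J C).det ≠ 0 := by
  obtain ⟨J, hJ⟩ := A.exists_linearIndependent_submatrix_row hr
  have hrank : r ≤ (A.submatrix J id).transpose.rank := by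
    rw [Matrix.rank_transpose, hJ.rank_matrix, Fintype.card_fin]
  obtain ⟨C, hC⟩ := Matrix.exists_linearIndependent_submatrix_row _ hrank
  refine ⟨J, C, ?_⟩
  rw [← Matrix.det_transpose, ← isUnit_iff_ne_zero, ← Matrix.isUnit_iff_isUnit_det]
  exact Matrix.linearIndependent_rows_iff_isUnit.mp hC

lemma Matrix.le_rank_of_det_submatrix_ne_zero (A : Matrix m l k) {r : ℕ} {J : Fin r → m}
    {C : Fin r → l} (h : (A.submatrix J C).det ≠ 0) : r ≤ A.rank := by
  have := A.rank_submatrix_le J C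
  rwa [Matrix.rank_of_det_ne_zero h, Fintype.card_fin] at this

lemma Matrix.rank_map_algebraMap_le [Fintype m] {k' : Type*} [Field k'] [Algebra k k']
    (A : Matrix m l k) :
    (A.map (algebraMap k k')).rank ≤ A.rank := by
  obtain ⟨J, C, h⟩ := (A.map (algebraMap k k')).exists_det_submatrix_ne_zero le_rfl
  refine A.le_rank_of_det_submatrix_ne_zero (J := J) (C := C) fun h0 ↦ h ?_
  rw [Matrix.submatrix_map, ← RingHom.mapMatrix_apply, ← RingHom.map_det, h0, map_zero]

end LinearAlgebra

section Trdeg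

lemma injective_of_det_submatrix_ne_zero {R m l : Type*} [CommRing R] {r : ℕ}
    {N : Matrix m l R} {J : Fin r → m} {C : Fin r → l} (hdet : (N.submatrix J C).det ≠ 0) :
    Function.Injective J := by
  intro a b hab
  by_contra hne
  exact hdet (Matrix.det_zero_of_row_eq hne (by ext; simp [hab]))

lemma ncard_compl_range_of_det_submatrix_ne_zero {R l : Type*} [CommRing R] {r p : ℕ}
    {N : Matrix (Fin p) l R} {J : Fin r → Fin p} {C : Fin r → l}
    (hdet : (N.submatrix J C).det ≠ 0) : (Set.range J)ᶜ.ncard = p - r := by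
  rw [Set.ncard_compl, Nat.card_eq_fintype_card, Fintype.card_fin,
    Set.ncard_range_of_injective (injective_of_det_submatrix_ne_zero hdet),
    Nat.card_eq_fintype_card, Fintype.card_fin]

lemma trdeg_le_of_vecMul_eq_zero {R E : Type*} [CommRing R] [CommRing E]
    [IsDomain E] [Algebra R E] [FaithfulSMul R E] {p r : ℕ} {l : Type*}
    (N : Matrix (Fin p) l R) {J : Fin r → Fin p} {C : Fin r → l}
    (hdet : (N.submatrix J C).det ≠ 0) (y : Fin p → E)
    (hy : Matrix.vecMul y (N.map (algebraMap R E)) = 0)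
    (htop : Algebra.adjoin R (Set.range y) = ⊤) :
    Algebra.trdeg R E ≤ ((p - r : ℕ) : Cardinal) := by
  have hJ := injective_of_det_submatrix_ne_zero hdet
  let T : Set E := y '' (Set.range J)ᶜ
  have hmem (j : Fin p) (hj : j ∉ Set.range J) : y j ∈ Algebra.adjoin R T :=
    Algebra.subset_adjoin ⟨j, hj, rfl⟩
  have hmem' (a : Fin r) : (N.submatrix J C).det • y (J a) ∈ Algebra.adjoin R T := by
    let M : Matrix (Fin r) (Fin r) E := (algebraMap R E).mapMatrix (N.submatrix J C)
    have hw (c : Fin r) : Matrix.vecMul (y ∘ J) M c ∈ Algebra.adjoin R T := by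
      have h : ∑ j, y j * algebraMap R E (N j (C c)) = 0 := congrFun hy (C c)
      rw [← Finset.sum_add_sum_compl (Finset.univ.image J), Finset.sum_image hJ.injOn] at h
      have h' : Matrix.vecMul (y ∘ J) M c =
          -∑ j ∈ (Finset.univ.image J)ᶜ, y j * algebraMap R E (N j (C c)) :=
        eq_neg_of_add_eq_zero_left h
      rw [h']
      refine neg_mem (sum_mem fun j hj ↦ mul_mem (hmem j ?_) (Subalgebra.algebraMap_mem _ _))
      simpa using hj
    have hM : Matrix.vecMul (Matrix.vecMul (y ∘ J) M) M.adjugate = M.det • (y ∘ J) := by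
      rw [Matrix.vecMul_vecMul, Matrix.mul_adjugate, Matrix.vecMul_smul, Matrix.vecMul_one]
    have ha := congrFun hM a
    rw [← RingHom.map_det, ← RingHom.map_adjugate] at ha
    rw [Algebra.smul_def]
    refine ha.subst (motive := (· ∈ Algebra.adjoin R T)) ?_
    exact sum_mem (t := Finset.univ) (f := fun c ↦ Matrix.vecMul (y ∘ J) M c *
      algebraMap R E ((N.submatrix J C).adjugate c a)) fun c _ ↦ mul_mem (hw c)
      (Subalgebra.algebraMap_mem _ ((N.submatrix J C).adjugate c a))
  have halg : Algebra.IsAlgebraic (Algebra.adjoin R T) E := by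
    refine ⟨fun e ↦ IsAlgebraic.adjoin_of_forall_isAlgebraic (s := Set.range y) ?_ ?_⟩
    · rintro _ ⟨⟨j, rfl⟩, hj⟩
      by_cases hjJ : j ∈ Set.range J
      · obtain ⟨a, rfl⟩ := hjJ
        refine IsAlgebraic.of_smul (y := algebraMap R (Algebra.adjoin R T) (N.submatrix J C).det)
          (mem_nonZeroDivisors_of_ne_zero ?_) ?_
        · exact fun h ↦ hdet ((FaithfulSMul.algebraMap_eq_zero_iff R E).mp
            (congrArg Subtype.val h))
        · rw [algebraMap_smul]
          exact isAlgebraic_algebraMap (⟨_, hmem' a⟩ : Algebra.adjoin R T)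
      · exact isAlgebraic_algebraMap (⟨y j, hmem j hjJ⟩ : Algebra.adjoin R T)
    · exact isAlgebraic_algebraMap (⟨e, htop ▸ Algebra.mem_top⟩ : Algebra.adjoin R (Set.range y))
  refine (Algebra.IsAlgebraic.trdeg_le_cardinalMk R T).trans ?_
  rw [← Set.cast_ncard T.toFinite]
  refine Nat.cast_le.mpr ((Set.ncard_image_le (Set.toFinite _)).trans ?_)
  exact (ncard_compl_range_of_det_submatrix_ne_zero hdet).le

end Trdeg

section Append

variable {F L : Type u} [Field F] [Field L] [Algebra F L] {p q : ℕ}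

lemma Fin.range_append {α : Type*} (a : Fin p → α) (b : Fin q → α) :
    Set.range (Fin.append a b) = Set.range a ∪ Set.range b := by
  apply Set.Subset.antisymm
  · rintro _ ⟨i, rfl⟩
    induction i using Fin.addCases with
    | left i => exact .inl ⟨i, by simp⟩
    | right i => exact .inr ⟨i, by simp⟩
  · rintro _ (⟨i, rfl⟩ | ⟨i, rfl⟩)
    · exact ⟨Fin.castAdd q i, by simp⟩
    · exact ⟨Fin.natAdd p i, by simp⟩

lemma trdeg_adjoin_append {L' : Type u} [Field L'] [Algebra F L'] [Algebra L L']
    [IsScalarTower F L L'] (ξ : Fin p → L) (η : Fin q → L') :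
    Algebra.trdeg F (Algebra.adjoin F (Set.range (Fin.append (algebraMap L L' ∘ ξ) η))) =
      Algebra.trdeg F (Algebra.adjoin F (Set.range ξ)) +
        Algebra.trdeg (Algebra.adjoin F (Set.range ξ))
          (Algebra.adjoin (Algebra.adjoin F (Set.range ξ)) (Set.range η)) := by
  rw [Fin.range_append, Set.range_comp, Algebra.adjoin_algebraMap_image_union_eq_adjoin_adjoin]
  have : FaithfulSMul (Algebra.adjoin F (Set.range ξ))
      (Algebra.adjoin (Algebra.adjoin F (Set.range ξ)) (Set.range η)) := by
    rw [faithfulSMul_iff_algebraMap_injective]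
    intro a b hab
    exact Subtype.ext ((algebraMap L L').injective (congrArg Subtype.val hab))
  exact (trdeg_add_eq F (Algebra.adjoin F (Set.range ξ))
    (A := Algebra.adjoin (Algebra.adjoin F (Set.range ξ)) (Set.range η))).symm

lemma trdeg_adjoin_append_le {l : Type*} [Fintype l] (ξ : Fin p → L) (η : Fin q → L)
    (N : Matrix (Fin q) l L) (hN : ∀ j c, N j c ∈ Algebra.adjoin F (Set.range ξ))
    (hη : Matrix.vecMul η N = 0) :
    Algebra.trdeg F (Algebra.adjoin F (Set.range (Fin.append ξ η))) ≤
      Algebra.trdeg F (Algebra.adjoin F (Set.range ξ)) + ((q - N.rank : ℕ) : Cardinal) := by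
  refine (trdeg_adjoin_append (L' := L) ξ η).le.trans ?_
  gcongr
  set A := Algebra.adjoin F (Set.range ξ)
  obtain ⟨J, C, hdet⟩ := N.exists_det_submatrix_ne_zero le_rfl
  let N' : Matrix (Fin q) l A := Matrix.of fun j c ↦ ⟨N j c, hN j c⟩
  have : FaithfulSMul A (Algebra.adjoin A (Set.range η)) := by
    rw [faithfulSMul_iff_algebraMap_injective]
    intro a b hab
    have : (a : L) = b := congrArg (Algebra.adjoin A (Set.range η)).val hab
    exact Subtype.ext this
  refine trdeg_le_of_vecMul_eq_zero (E := Algebra.adjoin A (Set.range η)) N' (J := J) (C := C)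
    ?_ (fun j ↦ ⟨η j, Algebra.subset_adjoin ⟨j, rfl⟩⟩) ?_ ?_
  · intro h
    have := congrArg A.val h
    rw [AlgHom.map_det, map_zero] at this
    exact hdet this
  · ext c
    have := congrFun hη c
    simp [Matrix.vecMul, dotProduct] at this ⊢
    exact this
  · have hrange : Set.range (fun j ↦ (⟨η j, Algebra.subset_adjoin ⟨j, rfl⟩⟩ :
        Algebra.adjoin A (Set.range η))) = Subtype.val ⁻¹' Set.range η := by
      ext x
      simp [Subtype.ext_iff]
    rw [hrange]
    exact Algebra.adjoin_adjoin_coe_preimage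

lemma exists_le_trdeg_adjoin_append {l : Type*} [Fintype l] (ξ : Fin p → L)
    (N : Matrix (Fin q) l L) :
    ∃ (L' : Type u) (_ : Field L') (_ : Algebra F L') (_ : Algebra L L')
      (_ : IsScalarTower F L L') (η : Fin q → L'),
      Matrix.vecMul η (N.map (algebraMap L L')) = 0 ∧
      Algebra.trdeg F (Algebra.adjoin F (Set.range ξ)) + ((q - N.rank : ℕ) : Cardinal) ≤
        Algebra.trdeg F
          (Algebra.adjoin F (Set.range (Fin.append (algebraMap L L' ∘ ξ) η))) := by
  obtain ⟨J, C, hdet⟩ := N.exists_det_submatrix_ne_zero le_rfl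
  let ι := ((Set.range J)ᶜ : Set (Fin q))
  have hcard : Nat.card ι = q - N.rank := ncard_compl_range_of_det_submatrix_ne_zero hdet
  let L' := FractionRing (MvPolynomial ι L)
  let t : ι → L' := fun j ↦ algebraMap (MvPolynomial ι L) L' (X j)
  have ht : AlgebraicIndependent L t :=
    (algebraicIndependent_X ι L).map' (f := IsScalarTower.toAlgHom L (MvPolynomial ι L) L')
      (IsFractionRing.injective _ _)
  let N' := N.map (algebraMap L L')
  let f : LinearMap.ker N'.vecMulLinear →ₗ[L'] (ι → L') :=
    (LinearMap.funLeft L' L' Subtype.val).comp (Submodule.subtype _)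
  have hf : Function.Injective f := by
    rw [injective_iff_map_eq_zero]
    rintro ⟨y, hy⟩ h0
    have hy0 (j : Fin q) (hj : j ∉ Set.range J) : y j = 0 := congrFun h0 ⟨j, hj⟩
    have hdet' : (N'.submatrix J C).det ≠ 0 := by
      rw [Matrix.submatrix_map, ← RingHom.mapMatrix_apply, ← RingHom.map_det]
      simpa using hdet
    have hJy : y ∘ J = 0 := by
      refine Matrix.eq_zero_of_vecMul_eq_zero hdet' ?_
      ext c
      have h : ∑ j, y j * N' j (C c) = 0 := congrFun hy (C c)
      rw [← Finset.sum_subset (Finset.subset_univ (Finset.univ.image J)) fun j _ hj ↦ by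
        rw [hy0 j (by simpa using hj), zero_mul],
        Finset.sum_image (injective_of_det_submatrix_ne_zero hdet).injOn] at h
      exact h
    ext j
    by_cases hj : j ∈ Set.range J
    · obtain ⟨a, rfl⟩ := hj
      exact congrFun hJy a
    · exact hy0 j hj
  have hfin : Module.finrank L' (LinearMap.ker N'.vecMulLinear) = Module.finrank L' (ι → L') := by
    refine le_antisymm (LinearMap.finrank_le_finrank_of_injective hf) ?_
    have h1 := N'.vecMulLinear.finrank_range_add_finrank_ker
    have h2 : Module.finrank L' (LinearMap.range N'.vecMulLinear) = N'.rank := by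
      rw [← Matrix.rank_transpose, Matrix.rank, Matrix.mulVecLin_transpose]
    have h3 : N'.rank ≤ N.rank := N.rank_map_algebraMap_le
    rw [Module.finrank_fintype_fun_eq_card, Fintype.card_fin] at h1
    rw [Module.finrank_fintype_fun_eq_card, ← Nat.card_eq_fintype_card, hcard]
    omega
  obtain ⟨⟨η, hη⟩, hηt⟩ :=
    (LinearMap.injective_iff_surjective_of_finrank_eq_finrank hfin).mp hf t
  refine ⟨L', inferInstance, inferInstance, inferInstance, inferInstance, η, hη, ?_⟩
  rw [trdeg_adjoin_append]
  gcongr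
  set A := Algebra.adjoin F (Set.range ξ)
  let t' : ι → Algebra.adjoin A (Set.range η) := fun j ↦ ⟨η j, Algebra.subset_adjoin ⟨j, rfl⟩⟩
  have ht' : AlgebraicIndependent A t' := by
    refine .of_comp (Algebra.adjoin A (Set.range η)).val ?_
    have : (Algebra.adjoin A (Set.range η)).val ∘ t' = t := hηt
    rw [this]
    exact ht.restrictScalars (K := L) Subtype.val_injective
  have := ht'.lift_cardinalMk_le_trdeg
  rw [← Nat.cast_card, hcard] at this
  simpa using this

end Append

section RankLocus

variable {F : Type u} [Field F] {p q l : ℕ} (P : Matrix (Fin q) (Fin l) (MvPolynomial (Fin p) F))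

/-- The points at which a matrix of polynomials has rank `r`. -/
def rankLocus (r : ℕ) : Set (Fin p → F) := {x | (P.map (aeval x)).rank = r}

/-- The pairs `(x, y)` such that `y` lies in the left kernel of the matrix of polynomials `P`
evaluated at `x`. -/
def kernelVariety : Set (Fin (p + q) → F) :=
  {w | Matrix.vecMul (w ∘ Fin.natAdd p) (P.map (aeval (w ∘ Fin.castAdd q))) = 0}

/-- The equations of `kernelVariety P`. -/
noncomputable def kernelEquation (c : Fin l) : MvPolynomial (Fin (p + q)) F :=
  ∑ j, X (Fin.natAdd p j) * rename (Fin.castAdd q) (P j c)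

variable {P}

lemma aeval_kernelEquation {L : Type*} [CommRing L] [Algebra F L] (w : Fin (p + q) → L)
    (c : Fin l) : aeval w (kernelEquation P c) =
      Matrix.vecMul (w ∘ Fin.natAdd p) (P.map (aeval (w ∘ Fin.castAdd q))) c := by
  simp [kernelEquation, Matrix.vecMul, dotProduct, aeval_rename]

lemma kernelVariety_eq_zeroLocus :
    kernelVariety P = zeroLocus F (Ideal.span (Set.range (kernelEquation P))) := by
  ext w
  rw [zeroLocus_span]
  simp only [kernelVariety, Set.mem_ofPred_eq, Set.forall_mem_range, aeval_kernelEquation,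
    funext_iff, Pi.zero_apply]

lemma aeval_eq_zero_of_mem_vanishingIdeal_kernelVariety [IsAlgClosed F] {L : Type*} [Field L]
    [Algebra F L] {w : Fin (p + q) → L}
    (hw : Matrix.vecMul (w ∘ Fin.natAdd p) (P.map (aeval (w ∘ Fin.castAdd q))) = 0)
    {f : MvPolynomial (Fin (p + q)) F} (hf : f ∈ vanishingIdeal F (kernelVariety P)) :
    aeval w f = 0 := by
  rw [kernelVariety_eq_zeroLocus, vanishingIdeal_zeroLocus_eq_radical] at hf
  obtain ⟨n, hn⟩ := hf
  have hle : Ideal.span (Set.range (kernelEquation P)) ≤ RingHom.ker (aeval w) := by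
    rw [Ideal.span_le]
    rintro _ ⟨c, rfl⟩
    exact (aeval_kernelEquation w c).trans (congrFun hw c)
  have h : aeval w (f ^ n) = 0 := hle hn
  rw [map_pow] at h
  exact eq_zero_of_pow_eq_zero h

lemma aeval_det_submatrix {L : Type*} [CommRing L] [Algebra F L] (ξ : Fin p → L) {r : ℕ}
    (J : Fin r → Fin q) (C : Fin r → Fin l) :
    aeval ξ (P.submatrix J C).det = ((P.map (aeval ξ)).submatrix J C).det := by
  rw [AlgHom.map_det]
  rfl

lemma rank_map_aeval_le_of_vanishingIdeal_le {L : Type*} [Field L] [Algebra F L] {ξ : Fin p → L}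
    {r : ℕ} (hξ : ∀ f ∈ vanishingIdeal F (rankLocus P r), aeval ξ f = 0) :
    (P.map (aeval ξ)).rank ≤ r := by
  by_contra! h
  obtain ⟨J, C, hdet⟩ := (P.map (aeval ξ)).exists_det_submatrix_ne_zero h
  rw [← aeval_det_submatrix] at hdet
  refine hdet (hξ _ fun x hx ↦ ?_)
  by_contra hne
  rw [aeval_det_submatrix] at hne
  have hx : (P.map (aeval x)).rank = r := hx
  have := (P.map (aeval x)).le_rank_of_det_submatrix_ne_zero hne
  omega

lemma aeval_eq_zero_of_mem_vanishingIdeal_rankLocus [IsAlgClosed F] {L : Type*} [Field L]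
    [Algebra F L] {ξ : Fin p → L} {f : MvPolynomial (Fin p) F}
    (hf : f ∈ vanishingIdeal F (rankLocus P (P.map (aeval ξ)).rank)) : aeval ξ f = 0 := by
  obtain ⟨J, C, hdet⟩ := (P.map (aeval ξ)).exists_det_submatrix_ne_zero le_rfl
  rw [← aeval_det_submatrix] at hdet
  have hprime : (RingHom.ker (aeval (R := F) ξ)).IsPrime := RingHom.ker_isPrime _
  have hmem : f * (P.submatrix J C).det ∈
      vanishingIdeal F (zeroLocus F (RingHom.ker (aeval (R := F) ξ))) := by
    intro x hx
    rw [map_mul, mul_eq_zero]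
    by_contra! hne
    refine hne.1 (hf x (le_antisymm ?_ ?_))
    · by_contra! h
      obtain ⟨J', C', hdet'⟩ := (P.map (aeval x)).exists_det_submatrix_ne_zero h
      rw [← aeval_det_submatrix] at hdet'
      refine hdet' (hx _ ?_)
      by_contra hne'
      have hne' : aeval ξ (P.submatrix J' C').det ≠ 0 := hne'
      rw [aeval_det_submatrix] at hne'
      have := (P.map (aeval ξ)).le_rank_of_det_submatrix_ne_zero hne'
      omega
    · have := hne.2
      rw [aeval_det_submatrix] at this
      exact (P.map (aeval x)).le_rank_of_det_submatrix_ne_zero this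
  rw [IsPrime.vanishingIdeal_zeroLocus] at hmem
  have h : aeval ξ (f * (P.submatrix J C).det) = 0 := hmem
  rw [map_mul] at h
  exact (mul_eq_zero.mp h).resolve_right hdet

lemma varDim_kernelVariety_ge [IsAlgClosed F] {r : ℕ} (hr : (rankLocus P r).Nonempty) :
    varDim (zariskiClosure (rankLocus P r)) + (q - r) ≤ varDim (kernelVariety P) := by
  have hsub : rankLocus P r ⊆ zariskiClosure (rankLocus P r) :=
    Set.subset_sInter fun W hW ↦ hW.2
  obtain ⟨L, _, _, ξ, hξ, hdim⟩ :=
    exists_varDim_le_trdeg_adjoin (isSubvariety_zariskiClosure (rankLocus P r)) (hr.mono hsub)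
  rw [vanishingIdeal_zariskiClosure] at hξ
  have hrank := rank_map_aeval_le_of_vanishingIdeal_le hξ
  obtain ⟨L', _, _, _, _, η, hη, hle⟩ :=
    exists_le_trdeg_adjoin_append (F := F) ξ (P.map (aeval ξ))
  have hmap : P.map (aeval (algebraMap L L' ∘ ξ)) = (P.map (aeval ξ)).map (algebraMap L L') := by
    ext j c
    exact aeval_algebraMap_apply L' ξ (P j c)
  have hV := trdeg_adjoin_le_varDim (V := kernelVariety P)
    (kernelVariety_eq_zeroLocus (P := P) ▸ isSubvariety_zeroLocus _)
    (Fin.append (algebraMap L L' ∘ ξ) η) fun f hf ↦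
      aeval_eq_zero_of_mem_vanishingIdeal_kernelVariety (P := P) (by
        have h1 : Fin.append (algebraMap L L' ∘ ξ) η ∘ Fin.natAdd p = η := by ext; simp
        have h2 : Fin.append (algebraMap L L' ∘ ξ) η ∘ Fin.castAdd q = algebraMap L L' ∘ ξ := by
          ext; simp
        rw [h1, h2, hmap, hη]) hf
  have key := ((add_le_add_left hdim _).trans hle).trans hV
  norm_cast at key
  omega

lemma exists_varDim_kernelVariety_le [IsAlgClosed F] :
    ∃ r ≤ q, (rankLocus P r).Nonempty ∧
      varDim (kernelVariety P) ≤ varDim (zariskiClosure (rankLocus P r)) + (q - r) := by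
  have hsub : IsSubvariety (kernelVariety P) :=
    kernelVariety_eq_zeroLocus (P := P) ▸ isSubvariety_zeroLocus _
  have hne : (kernelVariety P).Nonempty := ⟨0, Matrix.zero_vecMul _⟩
  obtain ⟨L, _, _, w, hw, hdim⟩ := exists_varDim_le_trdeg_adjoin hsub hne
  let ξ := w ∘ Fin.castAdd q
  let η := w ∘ Fin.natAdd p
  have hη : Matrix.vecMul η (P.map (aeval ξ)) = 0 := by
    ext c
    rw [← aeval_kernelEquation]
    refine hw _ fun v hv ↦ ?_
    rw [aeval_kernelEquation]
    exact congrFun hv c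
  have hwapp : Fin.append ξ η = w := Fin.append_castAdd_natAdd
  have hle := trdeg_adjoin_append_le (F := F) ξ η (P.map (aeval ξ)) (fun j c ↦ by
    rw [Algebra.adjoin_range_eq_range_aeval]
    exact ⟨P j c, rfl⟩) hη
  have hξ (f) (hf : f ∈ vanishingIdeal F (rankLocus P (P.map (aeval ξ)).rank)) :
      aeval ξ f = 0 := aeval_eq_zero_of_mem_vanishingIdeal_rankLocus hf
  refine ⟨(P.map (aeval ξ)).rank, ?_, ?_, ?_⟩
  · simpa using (P.map (aeval ξ)).rank_le_card_height
  · rw [Set.nonempty_iff_ne_empty]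
    intro h
    rw [h] at hξ
    simpa using hξ 1 (by simp)
  · have hX := trdeg_adjoin_le_varDim (isSubvariety_zariskiClosure (rankLocus P _)) ξ
      (by rwa [vanishingIdeal_zariskiClosure])
    rw [hwapp] at hle
    have key := (hdim.trans hle).trans (add_le_add_left hX _)
    exact_mod_cast key

lemma codim_kernelVariety_eq_iInf [IsAlgClosed F] :
    ((p + q - varDim (kernelVariety P) : ℕ) : ℕ∞) =
      ⨅ r : ℕ, ((r : ℕ∞) + codimE (rankLocus P r)) := by
  have hV : varDim (kernelVariety P) ≤ p + q := by
    refine (varDim_eq_ringKrullDim (V := kernelVariety P) ?_ ⟨0, Matrix.zero_vecMul _⟩).2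
    exact kernelVariety_eq_zeroLocus (P := P) ▸ isSubvariety_zeroLocus _
  apply le_antisymm
  · refine le_iInf fun r ↦ ?_
    rw [codimE]
    split_ifs with h
    · simp
    · have := varDim_kernelVariety_ge (Set.nonempty_iff_ne_empty.mpr h)
      norm_cast
      omega
  · obtain ⟨r, hrq, hr, hle⟩ := exists_varDim_kernelVariety_le (P := P)
    refine (iInf_le _ r).trans ?_
    rw [codimE, if_neg hr.ne_empty]
    have hX := (varDim_eq_ringKrullDim (isSubvariety_zariskiClosure (rankLocus P r))
      (hr.mono (Set.subset_sInter fun W hW ↦ hW.2))).2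
    norm_cast
    omega

end RankLocus

end GeometricRank

/-- Kopparty–Moshkovitz–Zuiddam: for any 3-tensor `T` over a field `K` (given by its coefficient
array `M`), `GR(T) = min over r of (r + codim {x : rank T(x,·,·) = r})`, all computed over the
algebraic closure of `K`. -/
theorem geometricRank_eq_min (K : Type*) [Field K] (n₁ n₂ n₃ : ℕ)
    (M : Fin n₁ → Fin n₂ → Fin n₃ → K)
    (V : Set (Fin (n₁ + n₂) → AlgebraicClosure K))
    (hV : V = {x | ∀ z : Fin n₃ → AlgebraicClosure K,
      ∑ i : Fin n₁, ∑ j : Fin n₂, ∑ k : Fin n₃,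
        algebraMap K (AlgebraicClosure K) (M i j k) *
          x (Fin.castAdd n₂ i) * x (Fin.natAdd n₁ j) * z k = 0}) :
    ((n₁ + n₂ - varDim V : ℕ) : ℕ∞) =
      ⨅ r : ℕ, ((r : ℕ∞) +
        codimE {x : Fin n₁ → AlgebraicClosure K |
          (Matrix.of fun (j : Fin n₂) (k : Fin n₃) =>
            ∑ i : Fin n₁, algebraMap K (AlgebraicClosure K) (M i j k) * x i).rank = r}) := by
  let P : Matrix (Fin n₂) (Fin n₃) (MvPolynomial (Fin n₁) (AlgebraicClosure K)) :=
    Matrix.of fun j k ↦ ∑ i, MvPolynomial.C (algebraMap K (AlgebraicClosure K) (M i j k)) *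
      MvPolynomial.X i
  have hP (x : Fin n₁ → AlgebraicClosure K) : P.map (MvPolynomial.aeval x) =
      Matrix.of fun j k ↦ ∑ i, algebraMap K (AlgebraicClosure K) (M i j k) * x i := by
    ext j k
    simp [P, MvPolynomial.aeval_eq_eval]
  have hVP : V = kernelVariety P := by
    subst hV
    ext w
    have hsum (z : Fin n₃ → AlgebraicClosure K) :
        ∑ i : Fin n₁, ∑ j : Fin n₂, ∑ k : Fin n₃, algebraMap K (AlgebraicClosure K) (M i j k) *
          w (Fin.castAdd n₂ i) * w (Fin.natAdd n₁ j) * z k =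
        Matrix.vecMul (w ∘ Fin.natAdd n₁)
          (P.map (MvPolynomial.aeval (w ∘ Fin.castAdd n₂))) ⬝ᵥ z := by
      rw [hP]
      simp only [Matrix.vecMul, dotProduct, Matrix.of_apply, Function.comp_apply, Finset.mul_sum,
        Finset.sum_mul]
      rw [Finset.sum_comm_cycle]
      refine Finset.sum_congr rfl fun k _ ↦ ?_
      rw [Finset.sum_comm]
      refine Finset.sum_congr rfl fun j _ ↦ Finset.sum_congr rfl fun i _ ↦ ?_
      ring
    simp only [Set.mem_ofPred_eq, kernelVariety, hsum]
    exact dotProduct_eq_zero_iff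
  rw [hVP, codim_kernelVariety_eq_iInf]
  simp only [rankLocus, hP]
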